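/- Let d ≥ 2, p > p_c and α ∈ (0,1). There exists a constant c > 0 such that, Q-almost surely on the event {|C| = +∞}, for all sufficiently large n: E_0^ω(α^{N_n}) ≥ exp(−c n^{d/(d+2)}). -/

import Mathlib

open MeasureTheory
open scoped ENNReal

namespace Perco

/-- Vertices of the lattice `Z^d`. -/
abbrev Zd (d : ℕ) := Fin d → ℤ

/-- A percolation configuration: each (unordered) edge of the lattice is open or closed.
(Only the values on nearest-neighbour pairs matter.) -/
abbrev Config (d : ℕ) := Sym2 (Zd d) → Bool

/-- Lattice adjacency: `(x,y) ∈ E^d`. -/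
def latAdj {d : ℕ} (x y : Zd d) : Prop := (∑ i, |x i - y i|) = 1

/-- Open adjacency in the configuration `ω`. -/
def openAdj {d : ℕ} (ω : Config d) (x y : Zd d) : Prop :=
  latAdj x y ∧ ω s(x, y) = true

/-- `C`: the open cluster of the origin. -/
def cluster {d : ℕ} (ω : Config d) : Set (Zd d) :=
  {y | Relation.ReflTransGen (openAdj ω) 0 y}

/-- `Q` is the product measure making the edge states i.i.d. Bernoulli(p). -/
def IsBernoulli {d : ℕ} (p : ℝ) (Q : Measure (Config d)) : Prop :=
  IsProbabilityMeasure Q ∧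
    ∀ (s : Finset (Sym2 (Zd d))) (f : Sym2 (Zd d) → Bool),
      Q {ω : Config d | ∀ e ∈ s, ω e = f e} =
        ∏ e ∈ s, (if f e then ENNReal.ofReal p else ENNReal.ofReal (1 - p))

/-- The critical probability `p_c`. -/
noncomputable def pc (d : ℕ) : ℝ :=
  sSup {p : ℝ | 0 ≤ p ∧ p ≤ 1 ∧
    ∀ Q : Measure (Config d), IsBernoulli p Q → Q {ω | (cluster ω).Infinite} = 0}

/-- The box `B_n = [-n,n]^d`. -/
def box (d n : ℕ) : Set (Zd d) := {x | ∀ i, |x i| ≤ (n : ℤ)}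

/-- `C_n`: the connected component of `0` in `C ∩ B_n`. -/
def clusterN {d : ℕ} (ω : Config d) (n : ℕ) : Set (Zd d) :=
  {y | Relation.ReflTransGen
    (fun a b => openAdj ω a b ∧ a ∈ box d n ∧ b ∈ box d n) 0 y}

/-- `A` is connected in the open subgraph. -/
def ConnOpen {d : ℕ} (ω : Config d) (A : Set (Zd d)) : Prop :=
  ∀ x ∈ A, ∀ y ∈ A,
    Relation.ReflTransGen (fun a b => openAdj ω a b ∧ a ∈ A ∧ b ∈ A) x y

/-- `A` is connected in the lattice. -/
def ConnLat {d : ℕ} (A : Set (Zd d)) : Prop :=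
  ∀ x ∈ A, ∀ y ∈ A,
    Relation.ReflTransGen (fun a b => latAdj a b ∧ a ∈ A ∧ b ∈ A) x y

/-- The boundary `∂_{C^g} A` = open lattice edges from `A` to its complement. -/
def bdry {d : ℕ} (ω : Config d) (A : Set (Zd d)) : Set (Zd d × Zd d) :=
  {e | openAdj ω e.1 e.2 ∧ e.1 ∈ A ∧ e.2 ∉ A}

/-- The profile `f_c` (at scale `n`, exponent `γ`). -/
noncomputable def fcut (d : ℕ) (γ c : ℝ) (n : ℕ) (x : ℝ) : ℝ :=
  if x < c * (n : ℝ) ^ γ then 1 else x ^ (1 - 1 / (d : ℝ))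

/-- `ν(x)`: number of open neighbours of `x`. -/
noncomputable def nu {d : ℕ} (ω : Config d) (x : Zd d) : ℕ :=
  Set.ncard {y | openAdj ω x y}

-- Transition kernel of the simple random walk on the open subgraph.
open Classical in
noncomputable def step {d : ℕ} (ω : Config d) (x y : Zd d) : ℝ :=
  if openAdj ω x y then ((nu ω x : ℝ))⁻¹ else 0

/-- Weight of a path of length `n`. -/
noncomputable def pathW {d n : ℕ} (ω : Config d) (γ : Fin (n + 1) → Zd d) : ℝ :=
  ∏ i : Fin n, step ω (γ i.castSucc) (γ i.succ)

/-- `N_n`: number of distinct sites visited by the path. -/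
noncomputable def visits {d n : ℕ} (γ : Fin (n + 1) → Zd d) : ℕ :=
  (Set.range γ).ncard

/-- `P_0^ω(E)`, the probability of a path event for the walk started at 0. -/
noncomputable def PWalk {d : ℕ} (ω : Config d) (n : ℕ)
    (E : (Fin (n + 1) → Zd d) → Prop) : ℝ :=
  ∑' γ : Fin (n + 1) → Zd d,
    Set.indicator {γ | γ 0 = 0 ∧ E γ} (fun γ => pathW ω γ) γ

/-- `E_0^ω(α^{N_n})`. -/
noncomputable def LaplaceN {d : ℕ} (ω : Config d) (α : ℝ) (n : ℕ) : ℝ :=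
  ∑' γ : Fin (n + 1) → Zd d,
    Set.indicator {γ | γ 0 = 0} (fun γ => pathW ω γ * α ^ visits γ) γ

/-- `E_0^ω(α^{N_n} 1_{X_n = 0})`. -/
noncomputable def LaplaceNReturn {d : ℕ} (ω : Config d) (α : ℝ) (n : ℕ) : ℝ :=
  ∑' γ : Fin (n + 1) → Zd d,
    Set.indicator {γ | γ 0 = 0 ∧ γ (Fin.last n) = 0}
      (fun γ => pathW ω γ * α ^ visits γ) γ

/-- Vertices of the wreath product `C^g ≀ Z/2Z` (lamplighter states). -/
abbrev Lamp (d : ℕ) := Zd d × (Zd d →₀ ZMod 2)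

/-- Flip a lamp configuration at one point. -/
noncomputable def flipAt {σ : Type*} (f : σ →₀ ZMod 2) (x : σ) : σ →₀ ZMod 2 :=
  f + Finsupp.single x 1

/-- Transition kernel of the lamplighter walk `Z` with parameter `α`. -/
noncomputable def ptilde {d : ℕ} (ω : Config d) (α : ℝ) (u v : Lamp d) : ℝ :=
  Set.indicator
    {q : Lamp d × Lamp d | ∀ x, x ≠ q.1.1 → x ≠ q.2.1 → q.1.2 x = q.2.2 x}
    (fun q => (if q.2.2 q.1.1 = 0 then α else 1 - α) *
      (if q.2.2 q.2.1 = 0 then α else 1 - α) * step ω q.1.1 q.2.1) (u, v)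

/-- `P̃_o^ω(Z_n = o)`: return probability of the lamplighter walk. -/
noncomputable def ZReturn {d : ℕ} (ω : Config d) (α : ℝ) (n : ℕ) : ℝ :=
  ∑' γ : Fin (n + 1) → Lamp d,
    Set.indicator {γ | γ 0 = (0, 0) ∧ γ (Fin.last n) = (0, 0)}
      (fun γ => ∏ i : Fin n, ptilde ω α (γ i.castSucc) (γ i.succ)) γ

/-- Vertex set of the wreath product over a vertex set `V` of the base. -/
def wVert {d : ℕ} (V : Set (Zd d)) : Set (Lamp d) :=
  {u | u.1 ∈ V ∧ ↑u.2.support ⊆ V}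

/-- Adjacency in the wreath product `C^g ≀ Z/2Z`. -/
def wAdj {d : ℕ} (ω : Config d) (u v : Lamp d) : Prop :=
  (u.1 = v.1 ∧ (∀ x, x ≠ u.1 → u.2 x = v.2 x) ∧ u.2 u.1 ≠ v.2 u.1) ∨
    (u.2 = v.2 ∧ openAdj ω u.1 v.1)

/-- Boundary of `U` in the wreath product `C^g ≀ Z/2Z`. -/
def wBdry {d : ℕ} (ω : Config d) (U : Set (Lamp d)) : Set (Lamp d × Lamp d) :=
  {e | e.1 ∈ U ∧ e.2 ∈ wVert (cluster ω) \ U ∧ wAdj ω e.1 e.2}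

/-- Følner function `Fol_{C_n^g}^{C^g}` (with value `⊤` when no set qualifies). -/
noncomputable def FolC {d : ℕ} (ω : Config d) (n : ℕ) (k : ℝ) : ℝ≥0∞ :=
  sInf {m : ℝ≥0∞ | ∃ A : Set (Zd d), A ⊆ clusterN ω n ∧ A.Nonempty ∧
    ((bdry ω A).ncard : ℝ) / (A.ncard : ℝ) ≤ 1 / k ∧ m = (A.ncard : ℝ≥0∞)}

/-- Følner function `Fol_{C_n^g ≀ Z/2Z}^{C^g ≀ Z/2Z}`. -/
noncomputable def FolW {d : ℕ} (ω : Config d) (n : ℕ) (k : ℝ) : ℝ≥0∞ :=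
  sInf {m : ℝ≥0∞ | ∃ U : Set (Lamp d), U ⊆ wVert (clusterN ω n) ∧ U.Nonempty ∧
    ((wBdry ω U).ncard : ℝ) / (U.ncard : ℝ) ≤ 1 / k ∧ m = (U.ncard : ℝ≥0∞)}

/-- Degree of a configuration `f` in the graph `K_U`. -/
noncomputable def Kdeg {d : ℕ} (U : Set (Lamp d)) (f : Zd d →₀ ZMod 2) : ℕ :=
  Set.ncard {g : Zd d →₀ ZMod 2 | ∃ x : Zd d, (x, f) ∈ U ∧ (x, g) ∈ U ∧ g = flipAt f x}

/-- A point `u = (x,f)` of `U` is bad if `(x, f̄_x) ∉ U`. -/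
def badPt {d : ℕ} (U : Set (Lamp d)) (u : Lamp d) : Prop :=
  (u.1, flipAt u.2 u.1) ∉ U

/-- `D(0,x) ≤ r`: the chemical distance from the origin to `x` is at most `r`. -/
def chemLE {d : ℕ} (ω : Config d) (x : Zd d) (r : ℕ) : Prop :=
  ∃ m ≤ r, ∃ γ : ℕ → Zd d, γ 0 = 0 ∧ γ m = x ∧ ∀ i < m, openAdj ω (γ i) (γ (i + 1))

/-- `B_r(C)`: chemical ball of radius `r` around the origin. -/
def chemBall {d : ℕ} (ω : Config d) (r : ℕ) : Set (Zd d) := {x | chemLE ω x r}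

/-- Lattice connected component of `x` inside a vertex set `V`. -/
def latCompIn {d : ℕ} (V : Set (Zd d)) (x : Zd d) : Set (Zd d) :=
  {y | Relation.ReflTransGen (fun a b => latAdj a b ∧ a ∈ V ∧ b ∈ V) x y}

/-- Open connected component of `x` inside a vertex set `V`. -/
def openCompIn {d : ℕ} (ω : Config d) (V : Set (Zd d)) (x : Zd d) : Set (Zd d) :=
  {y | Relation.ReflTransGen (fun a b => openAdj ω a b ∧ a ∈ V ∧ b ∈ V) x y}

/-- `L_n`: a connected component of the open subgraph inside `B_n` of maximal cardinality. -/
def IsLargestComp {d : ℕ} (ω : Config d) (n : ℕ) (L : Set (Zd d)) : Prop :=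
  (∃ x ∈ box d n, L = openCompIn ω (box d n) x) ∧
    ∀ y ∈ box d n, (openCompIn ω (box d n) y).ncard ≤ L.ncard

/-- `\bar L`: the connected component of `L` in the full open subgraph. -/
def closureOf {d : ℕ} (ω : Config d) (L : Set (Zd d)) : Set (Zd d) :=
  {y | ∃ x ∈ L, Relation.ReflTransGen (openAdj ω) x y}

/-- The boundary `∂_{\bar L_n^g} A`. -/
def bdryBar {d : ℕ} (ω : Config d) (n : ℕ) (L A : Set (Zd d)) : Set (Zd d × Zd d) :=
  {e | openAdj ω e.1 e.2 ∧ e.1 ∈ A ∩ closureOf ω L ∧ e.2 ∈ box d (n + 1) \ A}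

/-- `n(A)`: number of connected components of `B_n − L` containing a component of `A`. -/
noncomputable def nComp {d : ℕ} (n : ℕ) (L A : Set (Zd d)) : ℕ :=
  Set.ncard {P : Set (Zd d) |
    (∃ x ∈ box d n \ L, P = latCompIn (box d n \ L) x) ∧
    ∃ x ∈ A, latCompIn A x ⊆ P}

/-- The killed kernel `P^{B_r(C)}` acting on functions. -/
noncomputable def Pball {d : ℕ} (ω : Config d) (r : ℕ) (f : Zd d → ℝ) : Zd d → ℝ :=
  Set.indicator (chemBall ω r) (fun x =>
    ∑' y : Zd d, Set.indicator (chemBall ω r) (fun y => step ω x y * f y) y)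

/-- The Dirichlet form `ξ(f,f) = ((Id − P^{B_r(C)}) 1_{B_r(C)} f | f)_ν`. -/
noncomputable def dirichletForm {d : ℕ} (ω : Config d) (r : ℕ) (f : Zd d → ℝ) : ℝ :=
  ∑' x : Zd d, (nu ω x : ℝ) * f x *
    (Set.indicator (chemBall ω r) f x - Pball ω r (Set.indicator (chemBall ω r) f) x)

/-- `‖f‖²_{l²(ν)}`. -/
noncomputable def normSq {d : ℕ} (ω : Config d) (f : Zd d → ℝ) : ℝ :=
  ∑' x : Zd d, (nu ω x : ℝ) * f x ^ 2

/-- `λ_1(B_r(C))`: smallest Dirichlet eigenvalue of the killed walk. -/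
noncomputable def lambda1 {d : ℕ} (ω : Config d) (r : ℕ) : ℝ :=
  sInf {t : ℝ | ∃ f : Zd d → ℝ, f ≠ 0 ∧ Function.support f ⊆ chemBall ω r ∧
    t = dirichletForm ω r f / normSq ω f}

/-! ### Lattice geometry -/

/-- The sup norm of a lattice vector, as a natural number. -/
noncomputable def supN {d : ℕ} (v : Zd d) : ℕ := Finset.univ.sup fun i => (v i).natAbs

lemma supN_le_iff {d : ℕ} (v : Zd d) (k : ℕ) : supN v ≤ k ↔ ∀ i, (v i).natAbs ≤ k := by
  simp [supN]

lemma natAbs_le_supN {d : ℕ} (v : Zd d) (i : Fin d) : (v i).natAbs ≤ supN v :=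
  (supN_le_iff v _).1 le_rfl i

/-- The sup-norm ball of radius `k` around `x`. -/
noncomputable def supBall {d : ℕ} (x : Zd d) (k : ℕ) : Finset (Zd d) :=
  Finset.Icc (fun i => x i - (k : ℤ)) (fun i => x i + (k : ℤ))

lemma mem_supBall {d : ℕ} {x y : Zd d} {k : ℕ} : y ∈ supBall x k ↔ supN (y - x) ≤ k := by
  rw [supBall, Finset.mem_Icc, supN_le_iff, Pi.le_def, Pi.le_def, ← forall_and]
  refine forall_congr' fun i => ?_
  simp only [Pi.sub_apply]
  omega

lemma card_supBall {d : ℕ} (x : Zd d) (k : ℕ) : (supBall x k).card = (2 * k + 1) ^ d := by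
  rw [supBall, Pi.card_Icc]
  have : ∀ i : Fin d, (Finset.Icc (x i - (k : ℤ)) (x i + k)).card = 2 * k + 1 := fun i => by
    rw [Int.card_Icc]; omega
  simp [this]

lemma supN_sub_comm {d : ℕ} (x y : Zd d) : supN (x - y) = supN (y - x) := by
  unfold supN
  congr 1
  funext i
  simp only [Pi.sub_apply]
  omega

lemma mem_supBall_comm {d : ℕ} {x y : Zd d} {k : ℕ} : y ∈ supBall x k ↔ x ∈ supBall y k := by
  rw [mem_supBall, mem_supBall, supN_sub_comm]

lemma supN_sub_le {d : ℕ} (x y z : Zd d) : supN (x - z) ≤ supN (x - y) + supN (y - z) := by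
  rw [supN_le_iff]
  intro i
  have h1 := natAbs_le_supN (x - y) i
  have h2 := natAbs_le_supN (y - z) i
  simp only [Pi.sub_apply] at *
  omega

lemma latAdj.symm {d : ℕ} {x y : Zd d} (h : latAdj x y) : latAdj y x := by
  unfold latAdj at *
  simpa only [abs_sub_comm] using h

lemma latAdj.supN_le {d : ℕ} {x y : Zd d} (h : latAdj x y) : supN (x - y) ≤ 1 := by
  rw [supN_le_iff]
  intro i
  have := Finset.single_le_sum (f := fun i => |x i - y i|) (fun j _ => abs_nonneg _)
    (Finset.mem_univ i)
  rw [latAdj] at h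
  simp only [Pi.sub_apply]
  rw [h] at this
  rw [Int.abs_eq_natAbs] at this
  omega

/-! ### The open graph -/

lemma openAdj.symm {d : ℕ} {ω : Config d} {x y : Zd d} (h : openAdj ω x y) : openAdj ω y x :=
  ⟨h.1.symm, by rw [Sym2.eq_swap]; exact h.2⟩

/-- The subgraph of open edges. -/
def openGraph {d : ℕ} (ω : Config d) : SimpleGraph (Zd d) where
  Adj := openAdj ω
  symm := ⟨fun _ _ h => h.symm⟩
  loopless := ⟨fun x h => by simpa [latAdj] using h.1⟩

lemma openAdj.mem_supBall {d : ℕ} {ω : Config d} {x y : Zd d} (h : openAdj ω x y) :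
    y ∈ supBall x 1 :=
  Perco.mem_supBall.2 h.symm.1.supN_le

lemma finite_neighbors {d : ℕ} (ω : Config d) (x : Zd d) : {y | openAdj ω x y}.Finite :=
  (supBall x 1).finite_toSet.subset fun _ h => openAdj.mem_supBall h

lemma nu_le {d : ℕ} (ω : Config d) (x : Zd d) : nu ω x ≤ 3 ^ d := by
  have h := Set.ncard_le_ncard (s := {y | openAdj ω x y}) (t := supBall x 1)
    (fun _ h => openAdj.mem_supBall h) (supBall x 1).finite_toSet
  rwa [Set.ncard_coe_finset, card_supBall] at h

lemma openAdj.nu_pos {d : ℕ} {ω : Config d} {x y : Zd d} (h : openAdj ω x y) : 0 < nu ω x :=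
  (Set.ncard_pos (finite_neighbors ω x)).2 ⟨y, h⟩

open Classical in
/-- Indicator of an open edge. -/
noncomputable def adjI {d : ℕ} (ω : Config d) (x y : Zd d) : ℝ := if openAdj ω x y then 1 else 0

lemma adjI_nonneg {d : ℕ} (ω : Config d) (x y : Zd d) : 0 ≤ adjI ω x y := by
  unfold adjI; split_ifs <;> norm_num

lemma adjI_comm {d : ℕ} (ω : Config d) (x y : Zd d) : adjI ω x y = adjI ω y x := by
  have h : openAdj ω x y ↔ openAdj ω y x := ⟨openAdj.symm, openAdj.symm⟩
  unfold adjI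
  split_ifs <;> tauto

lemma nu_mul_step {d : ℕ} (ω : Config d) (x y : Zd d) : (nu ω x : ℝ) * step ω x y = adjI ω x y := by
  unfold step adjI
  split_ifs with h
  · have := h.nu_pos
    field_simp
  · simp

lemma step_nonneg {d : ℕ} (ω : Config d) (x y : Zd d) : 0 ≤ step ω x y := by
  unfold step
  split_ifs <;> positivity

lemma sum_adjI_eq {d : ℕ} (ω : Config d) (x : Zd d) (T : Finset (Zd d)) (hT : supBall x 1 ⊆ T) :
    ∑ y ∈ T, adjI ω x y = nu ω x := by
  classical
  unfold adjI nu
  rw [Finset.sum_boole, ← Set.ncard_coe_finset]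
  congr 2
  ext y
  simp only [Finset.coe_filter, Set.mem_ofPred_eq, and_iff_right_iff_imp]
  exact fun h => hT h.mem_supBall

lemma sum_adjI_le {d : ℕ} (ω : Config d) (x : Zd d) (T : Finset (Zd d)) :
    ∑ y ∈ T, adjI ω x y ≤ nu ω x := by
  classical
  rw [← sum_adjI_eq ω x (T ∪ supBall x 1) Finset.subset_union_right]
  exact Finset.sum_le_sum_of_subset_of_nonneg Finset.subset_union_left
    fun _ _ _ => adjI_nonneg _ _ _

lemma sum_step_le_one {d : ℕ} (ω : Config d) (x : Zd d) (T : Finset (Zd d)) :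
    ∑ y ∈ T, step ω x y ≤ 1 := by
  rcases Nat.eq_zero_or_pos (nu ω x) with h | h
  · rw [Finset.sum_eq_zero]
    · norm_num
    · intro y _
      simp [step, h]
  · have h' : (0 : ℝ) < nu ω x := by exact_mod_cast h
    refine le_of_mul_le_mul_left ?_ h'
    rw [Finset.mul_sum, mul_one]
    simpa only [nu_mul_step] using sum_adjI_le ω x T

lemma openAdj.le_step {d : ℕ} {ω : Config d} {x y : Zd d} (h : openAdj ω x y) :
    ((3 : ℝ) ^ d)⁻¹ ≤ step ω x y := by
  have h1 : (0 : ℝ) < nu ω x := by exact_mod_cast h.nu_pos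
  have h2 : (nu ω x : ℝ) ≤ 3 ^ d := by exact_mod_cast nu_le ω x
  rw [step, if_pos h]
  gcongr

lemma supN_le_length {d : ℕ} {ω : Config d} {x y : Zd d} (w : (openGraph ω).Walk x y) :
    supN (y - x) ≤ w.length := by
  induction w with
  | nil => simp [supN]
  | @cons u v t h w ih =>
    have h1 : supN (v - u) ≤ 1 := (show openAdj ω u v from h).symm.1.supN_le
    have h2 := supN_sub_le t v u
    rw [SimpleGraph.Walk.length_cons]
    omega

lemma mem_cluster_iff {d : ℕ} {ω : Config d} {x : Zd d} :
    x ∈ cluster ω ↔ (openGraph ω).Reachable 0 x :=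
  ((openGraph ω).reachable_iff_reflTransGen 0 x).symm

lemma nu_pos_of_mem_cluster {d : ℕ} {ω : Config d} (hω : (cluster ω).Infinite) {x : Zd d}
    (hx : x ∈ cluster ω) : 0 < nu ω x := by
  by_cases h0 : x = 0
  · subst h0
    obtain ⟨y, hy, hne⟩ := hω.exists_notMem_finset {0}
    rcases Relation.ReflTransGen.cases_head hy with h | ⟨z, hz, _⟩
    · simp [← h] at hne
    · exact openAdj.nu_pos hz
  · rcases Relation.ReflTransGen.cases_tail hx with h | ⟨z, _, hz⟩
    · exact absurd h h0
    · exact hz.symm.nu_pos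

/-- The ball of radius `k` around the origin in the chemical distance. -/
def graphBall {d : ℕ} (ω : Config d) (k : ℕ) : Set (Zd d) :=
  {x | (openGraph ω).Reachable 0 x ∧ (openGraph ω).dist 0 x ≤ k}

lemma graphBall_subset {d : ℕ} (ω : Config d) (k : ℕ) : graphBall ω k ⊆ (supBall 0 k : Finset (Zd d)) := by
  rintro x ⟨hx, hk⟩
  obtain ⟨w, hw⟩ := hx.exists_walk_length_eq_dist
  have := supN_le_length w
  rw [Finset.mem_coe, mem_supBall]
  omega

lemma finite_graphBall {d : ℕ} (ω : Config d) (k : ℕ) : (graphBall ω k).Finite :=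
  (supBall 0 k).finite_toSet.subset (graphBall_subset ω k)

lemma ncard_graphBall_le {d : ℕ} (ω : Config d) (k : ℕ) :
    (graphBall ω k).ncard ≤ (2 * k + 1) ^ d := by
  have h := Set.ncard_le_ncard (graphBall_subset ω k) (supBall 0 k).finite_toSet
  rwa [Set.ncard_coe_finset, card_supBall] at h

lemma zero_mem_graphBall {d : ℕ} (ω : Config d) (k : ℕ) : (0 : Zd d) ∈ graphBall ω k :=
  ⟨SimpleGraph.Reachable.refl _, by simp⟩

lemma dist_le_succ {d : ℕ} {ω : Config d} {x y : Zd d} (hx : (openGraph ω).Reachable 0 x)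
    (h : openAdj ω x y) : (openGraph ω).dist 0 y ≤ (openGraph ω).dist 0 x + 1 := by
  obtain ⟨w, hw⟩ := hx.exists_walk_length_eq_dist
  have h' : (openGraph ω).Adj x y := h
  have := SimpleGraph.dist_le (w.concat h')
  rwa [SimpleGraph.Walk.length_concat, hw] at this

/-- By polynomial growth, some dilation of chemical balls does not more than double the volume. -/
lemma exists_doubling {d : ℕ} (ω : Config d) (s J : ℕ) (hJ : (2 * (J * s) + 1) ^ d < 2 ^ J) :
    ∃ j < J, (graphBall ω ((j + 1) * s)).ncard ≤ 2 * (graphBall ω (j * s)).ncard := by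
  by_contra! hc
  have key : ∀ j ≤ J, 2 ^ j ≤ (graphBall ω (j * s)).ncard := by
    intro j
    induction j with
    | zero =>
      intro _
      exact (Set.ncard_pos (finite_graphBall ω _)).2 ⟨0, zero_mem_graphBall ω _⟩
    | succ j ih =>
      intro hj
      have h1 := ih (by omega)
      have h2 := hc j (by omega)
      rw [pow_succ]
      omega
  exact absurd ((key J le_rfl).trans (ncard_graphBall_le ω _)) (not_le.2 hJ)

/-! ### The walk killed outside a finite set -/

/-- Transition operator of the walk killed outside `W`. -/
noncomputable def killed {d : ℕ} (ω : Config d) (W : Finset (Zd d)) (f : Zd d → ℝ) : Zd d → ℝ :=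
  fun x => ∑ y ∈ W, step ω x y * f y

/-- Probability that the walk started at `x` stays in `W` during the times `1, ..., n`. -/
noncomputable def stay {d : ℕ} (ω : Config d) (W : Finset (Zd d)) (n : ℕ) : Zd d → ℝ :=
  (killed ω W)^[n] fun _ => 1

section Killed

variable {d : ℕ} {ω : Config d} {W W' : Finset (Zd d)}

lemma stay_zero (x : Zd d) : stay ω W 0 x = 1 := rfl

lemma stay_succ (n : ℕ) (x : Zd d) :
    stay ω W (n + 1) x = ∑ y ∈ W, step ω x y * stay ω W n y := by
  unfold stay
  rw [Function.iterate_succ_apply']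
  rfl

lemma killed_mono {f g : Zd d → ℝ} (h : ∀ x, f x ≤ g x) (x : Zd d) :
    killed ω W f x ≤ killed ω W g x :=
  Finset.sum_le_sum fun y _ => mul_le_mul_of_nonneg_left (h y) (step_nonneg _ _ _)

lemma stay_nonneg (n : ℕ) (x : Zd d) : 0 ≤ stay ω W n x := by
  induction n generalizing x with
  | zero => rw [stay_zero]; norm_num
  | succ n ih =>
    rw [stay_succ]
    exact Finset.sum_nonneg fun y _ => mul_nonneg (step_nonneg _ _ _) (ih y)

lemma stay_mono (h : W ⊆ W') (n : ℕ) (x : Zd d) : stay ω W n x ≤ stay ω W' n x := by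
  induction n generalizing x with
  | zero => rw [stay_zero, stay_zero]
  | succ n ih =>
    rw [stay_succ, stay_succ]
    refine (Finset.sum_le_sum fun y _ =>
      mul_le_mul_of_nonneg_left (ih y) (step_nonneg _ _ _)).trans ?_
    exact Finset.sum_le_sum_of_subset_of_nonneg h
      fun y _ _ => mul_nonneg (step_nonneg _ _ _) (stay_nonneg _ _)

lemma stay_succ_le (n : ℕ) (x : Zd d) : stay ω W (n + 1) x ≤ stay ω W n x := by
  induction n generalizing x with
  | zero => simpa [stay_succ, stay_zero] using sum_step_le_one ω x W
  | succ n ih =>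
    rw [stay_succ (n + 1), stay_succ n]
    exact Finset.sum_le_sum fun y _ => mul_le_mul_of_nonneg_left (ih y) (step_nonneg _ _ _)

lemma stay_antitone (x : Zd d) : Antitone fun n => stay ω W n x :=
  antitone_nat_of_succ_le fun n => stay_succ_le n x

lemma le_stay_of_walk {x y : Zd d} (w : (openGraph ω).Walk x y) (hw : ∀ z ∈ w.support, z ∈ W)
    (n : ℕ) : (((3 : ℝ) ^ d)⁻¹) ^ w.length * stay ω W n y ≤ stay ω W (w.length + n) x := by
  induction w with
  | nil => simp
  | @cons u v t h w ih =>
    have hv : v ∈ W := hw v (by simp)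
    have ih' := ih fun z hz => hw z (by simp [hz])
    rw [SimpleGraph.Walk.length_cons, pow_succ', mul_assoc,
      show w.length + 1 + n = (w.length + n) + 1 by ring, stay_succ]
    refine le_trans ?_ (Finset.single_le_sum
      (f := fun y => step ω u y * stay ω W (w.length + n) y)
      (fun y _ => mul_nonneg (step_nonneg _ _ _) (stay_nonneg _ _)) hv)
    exact mul_le_mul (openAdj.le_step h) ih'
      (mul_nonneg (by positivity) (stay_nonneg _ _)) (step_nonneg _ _ _)

/-- Inner product on `W` weighted by the degrees. -/
noncomputable def ip (ω : Config d) (W : Finset (Zd d)) (f g : Zd d → ℝ) : ℝ :=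
  ∑ x ∈ W, nu ω x * (f x * g x)

lemma ip_killed_right (f g : Zd d → ℝ) :
    ip ω W f (killed ω W g) = ∑ x ∈ W, ∑ y ∈ W, adjI ω x y * (f x * g y) := by
  refine Finset.sum_congr rfl fun x _ => ?_
  simp only [killed, Finset.mul_sum]
  refine Finset.sum_congr rfl fun y _ => ?_
  rw [← nu_mul_step]
  ring

lemma ip_comm (f g : Zd d → ℝ) : ip ω W f g = ip ω W g f :=
  Finset.sum_congr rfl fun _ _ => by ring

lemma ip_killed_comm (f g : Zd d → ℝ) :
    ip ω W (killed ω W f) g = ip ω W f (killed ω W g) := by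
  rw [ip_comm, ip_killed_right, ip_killed_right, Finset.sum_comm]
  refine Finset.sum_congr rfl fun x _ => Finset.sum_congr rfl fun y _ => ?_
  rw [adjI_comm]
  ring

lemma ip_iterate_comm (n : ℕ) (f g : Zd d → ℝ) :
    ip ω W ((killed ω W)^[n] f) g = ip ω W f ((killed ω W)^[n] g) := by
  induction n generalizing f with
  | zero => rfl
  | succ n ih =>
    rw [Function.iterate_succ_apply, ih, ip_killed_comm,
      ← Function.iterate_succ_apply' (f := killed ω W)]

lemma ip_sq_le (f g : Zd d → ℝ) : ip ω W f g ^ 2 ≤ ip ω W f f * ip ω W g g := by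
  refine Finset.sum_sq_le_sum_mul_sum_of_sq_le_mul W
    (fun x _ => mul_nonneg (Nat.cast_nonneg _) (mul_self_nonneg _))
    (fun x _ => mul_nonneg (Nat.cast_nonneg _) (mul_self_nonneg _)) fun x _ => le_of_eq ?_
  ring

/-- A Rayleigh quotient bound propagates to iterates of the killed operator. -/
lemma pow_mul_le_ip_iterate {F : Zd d → ℝ} {θ : ℝ} (hθ : 0 ≤ θ) (hF : 0 < ip ω W F F)
    (h : θ * ip ω W F F ≤ ip ω W F (killed ω W F)) (k : ℕ) :
    θ ^ 2 ^ k * ip ω W F F ≤ ip ω W F ((killed ω W)^[2 ^ k] F) := by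
  induction k with
  | zero => simpa using h
  | succ k ih =>
    have h1 := ip_sq_le (ω := ω) (W := W) F ((killed ω W)^[2 ^ k] F)
    rw [ip_iterate_comm, ← Function.iterate_add_apply, ← two_mul, ← pow_succ'] at h1
    have h2 : (θ ^ 2 ^ k * ip ω W F F) ^ 2 ≤ (ip ω W F ((killed ω W)^[2 ^ k] F)) ^ 2 := by
      gcongr
    refine le_of_mul_le_mul_left ?_ hF
    calc ip ω W F F * (θ ^ 2 ^ (k + 1) * ip ω W F F) = (θ ^ 2 ^ k * ip ω W F F) ^ 2 := by
          rw [pow_succ 2 k, pow_mul]; ring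
      _ ≤ _ := h2.trans h1

lemma iterate_killed_le {F : Zd d → ℝ} {M : ℝ} (hF : ∀ x, F x ≤ M) (n : ℕ) (x : Zd d) :
    (killed ω W)^[n] F x ≤ M * stay ω W n x := by
  induction n generalizing x with
  | zero => simpa [stay_zero] using hF x
  | succ n ih =>
    rw [Function.iterate_succ_apply', stay_succ, Finset.mul_sum]
    refine (killed_mono ih x).trans (le_of_eq ?_)
    exact Finset.sum_congr rfl fun y _ => by ring

lemma pathW_cons {n : ℕ} (x : Zd d) (γ : Fin (n + 1) → Zd d) :
    pathW ω (Fin.cons x γ : Fin (n + 2) → Zd d) = step ω x (γ 0) * pathW ω γ := by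
  unfold pathW
  rw [Fin.prod_univ_succ]
  simp

lemma sum_pathW_eq_stay (n : ℕ) (x : Zd d) :
    ∑ γ : Fin n → W, pathW ω (Fin.cons x (fun i => (γ i : Zd d)) : Fin (n + 1) → Zd d) =
      stay ω W n x := by
  induction n generalizing x with
  | zero => simp [pathW, stay_zero]
  | succ n ih =>
    rw [← (Fin.consEquiv fun _ => W).sum_comp, Fintype.sum_prod_type, stay_succ,
      ← Finset.sum_coe_sort W]
    refine Finset.sum_congr rfl fun y _ => ?_
    rw [← ih, Finset.mul_sum]
    refine Finset.sum_congr rfl fun γ _ => ?_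
    have : (fun i => (((Fin.consEquiv fun _ => W) (y, γ) : Fin (n + 1) → W) i : Zd d)) =
        Fin.cons (y : Zd d) fun i => (γ i : Zd d) := by
      funext i
      refine Fin.cases ?_ (fun j => ?_) i <;> simp [Fin.consEquiv]
    rw [this, pathW_cons]
    simp

end Killed

lemma supN_le_of_pathW_ne_zero {d n : ℕ} {ω : Config d} {γ : Fin (n + 1) → Zd d} (h0 : γ 0 = 0)
    (hγ : pathW ω γ ≠ 0) (i : Fin (n + 1)) : supN (γ i) ≤ i := by
  have hstep : ∀ i : Fin n, openAdj ω (γ i.castSucc) (γ i.succ) := fun i => by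
    have := Finset.prod_ne_zero_iff.1 hγ i (Finset.mem_univ i)
    by_contra hc
    exact this (if_neg hc)
  induction i using Fin.induction with
  | zero => simp [h0, supN]
  | succ i ih =>
    have h1 := (hstep i).symm.1.supN_le
    have h2 := supN_sub_le (γ i.succ) (γ i.castSucc) 0
    simp only [sub_zero, Fin.val_castSucc, Fin.val_succ] at *
    omega

lemma summable_laplaceN {d : ℕ} (ω : Config d) (α : ℝ) (n : ℕ) :
    Summable fun γ : Fin (n + 1) → Zd d =>
      Set.indicator {γ | γ 0 = 0} (fun γ => pathW ω γ * α ^ visits γ) γ := by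
  refine summable_of_hasFiniteSupport ?_
  refine (Fintype.piFinset fun _ : Fin (n + 1) => supBall (0 : Zd d) n).finite_toSet.subset ?_
  intro γ hγ
  rw [Function.mem_support, Set.indicator_apply_ne_zero] at hγ
  rw [Finset.mem_coe, Fintype.mem_piFinset]
  intro i
  have := supN_le_of_pathW_ne_zero hγ.1 (left_ne_zero_of_mul hγ.2) i
  rw [mem_supBall, sub_zero]
  omega

lemma pathW_nonneg {d n : ℕ} (ω : Config d) (γ : Fin (n + 1) → Zd d) : 0 ≤ pathW ω γ :=
  Finset.prod_nonneg fun _ _ => step_nonneg _ _ _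

lemma pow_card_mul_stay_le_laplaceN {d : ℕ} {ω : Config d} {W : Finset (Zd d)} (h0 : 0 ∈ W)
    {α : ℝ} (hα : α ∈ Set.Ioo (0 : ℝ) 1) (n : ℕ) :
    α ^ W.card * stay ω W n 0 ≤ LaplaceN ω α n := by
  classical
  let e : (Fin n → W) ↪ (Fin (n + 1) → Zd d) :=
    ⟨fun γ => Fin.cons 0 fun i => (γ i : Zd d), fun γ γ' h => by
      funext i
      exact Subtype.ext (congrFun (Fin.cons_right_injective (α := fun _ => Zd d) 0 h) i)⟩
  refine le_trans ?_ ((summable_laplaceN ω α n).sum_le_tsum (Finset.univ.map e) fun γ _ =>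
    Set.indicator_nonneg (fun γ _ => mul_nonneg (pathW_nonneg ω γ) (pow_nonneg hα.1.le _)) γ)
  rw [Finset.sum_map, ← sum_pathW_eq_stay, Finset.mul_sum]
  refine Finset.sum_le_sum fun γ _ => ?_
  have hmem : e γ ∈ {γ : Fin (n + 1) → Zd d | γ 0 = 0} := rfl
  rw [Set.indicator_of_mem hmem, mul_comm]
  refine mul_le_mul_of_nonneg_left ?_ (pathW_nonneg ω _)
  refine pow_le_pow_of_le_one hα.1.le hα.2.le ?_
  rw [visits, ← Set.ncard_coe_finset]
  refine Set.ncard_le_ncard ?_ W.finite_toSet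
  rintro _ ⟨i, rfl⟩
  refine Fin.cases ?_ (fun j => ?_) i
  · exact h0
  · exact (γ j).2

/-! ### Test functions and the double counting argument -/

lemma ip_sub_ip_killed_le {d : ℕ} (ω : Config d) (U : Finset (Zd d)) (F : Zd d → ℝ)
    (hU : ∀ x ∉ U, F x = 0) (hF : ∀ x y, openAdj ω x y → (F x - F y) ^ 2 ≤ 1) :
    ip ω U F F - ip ω U F (killed ω U F) ≤ 3 ^ d * U.card := by
  classical
  set T : Finset (Zd d) := U ∪ U.biUnion fun x => supBall x 1 with hT
  have hUT : U ⊆ T := Finset.subset_union_left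
  have hball : ∀ x ∈ U, supBall x 1 ⊆ T := fun x hx =>
    (Finset.subset_biUnion_of_mem (fun x => supBall x 1) hx).trans Finset.subset_union_right
  have h1 : ip ω U F F = ∑ x ∈ T, ∑ y ∈ T, adjI ω x y * (F x * F x) := by
    rw [ip]
    rw [← Finset.sum_subset hUT fun x _ hx => by simp [hU x hx]]
    refine Finset.sum_congr rfl fun x hx => ?_
    rw [← Finset.sum_mul, sum_adjI_eq ω x T (hball x hx)]
  have h2 : ip ω U F (killed ω U F) = ∑ x ∈ T, ∑ y ∈ T, adjI ω x y * (F x * F y) := by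
    rw [ip_killed_right]
    rw [← Finset.sum_subset hUT fun x _ hx => by simp [hU x hx]]
    refine Finset.sum_congr rfl fun x hx => ?_
    rw [← Finset.sum_subset hUT fun y _ hy => by simp [hU y hy]]
  have h3 : ip ω U F F = ∑ x ∈ T, ∑ y ∈ T, adjI ω x y * (F y * F y) := by
    rw [h1, Finset.sum_comm]
    exact Finset.sum_congr rfl fun x _ => Finset.sum_congr rfl fun y _ => by rw [adjI_comm]
  let I : Zd d → ℝ := fun x => if x ∈ U then 1 else 0
  have h4 : ∑ x ∈ T, ∑ y ∈ T, adjI ω x y * I x ≤ 3 ^ d * U.card := by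
    rw [← Finset.sum_subset hUT fun x _ hx => by simp [I, hx]]
    calc ∑ x ∈ U, ∑ y ∈ T, adjI ω x y * I x ≤ ∑ _x ∈ U, (3 : ℝ) ^ d := by
          refine Finset.sum_le_sum fun x hx => ?_
          simp only [I, hx, if_true, mul_one]
          exact (sum_adjI_le ω x T).trans (by exact_mod_cast nu_le ω x)
      _ = 3 ^ d * U.card := by rw [Finset.sum_const, nsmul_eq_mul, mul_comm]
  have h5 : ∑ x ∈ T, ∑ y ∈ T, adjI ω x y * I y ≤ 3 ^ d * U.card := by
    rw [Finset.sum_comm]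
    refine le_trans (le_of_eq ?_) h4
    exact Finset.sum_congr rfl fun x _ => Finset.sum_congr rfl fun y _ => by rw [adjI_comm]
  have h6 : ∑ x ∈ T, ∑ y ∈ T, (adjI ω x y * (F x * F x) + adjI ω x y * (F y * F y)
      - 2 * (adjI ω x y * (F x * F y))) ≤
      ∑ x ∈ T, ∑ y ∈ T, (adjI ω x y * I x + adjI ω x y * I y) := by
    refine Finset.sum_le_sum fun x _ => Finset.sum_le_sum fun y _ => ?_
    have hsq : adjI ω x y * (F x - F y) ^ 2 ≤ adjI ω x y * (I x + I y) := by
      by_cases hxy : openAdj ω x y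
      · refine mul_le_mul_of_nonneg_left ?_ (adjI_nonneg _ _ _)
        have hb := hF x y hxy
        by_cases hx : x ∈ U <;> by_cases hy : y ∈ U <;> simp only [I, hx, hy, if_true, if_false]
        · linarith
        · linarith
        · linarith
        · simp [hU x hx, hU y hy]
      · simp [adjI, hxy]
    linarith
  simp only [Finset.sum_add_distrib, Finset.sum_sub_distrib, ← Finset.mul_sum] at h6
  linarith

open Classical in
/-- A bump function at scale `q` around `z`, cut off at chemical distance `R` from the origin. -/
noncomputable def bump {d : ℕ} (ω : Config d) (q R : ℕ) (z x : Zd d) : ℕ :=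
  if (openGraph ω).Reachable 0 x then
    min (2 * q - supN (x - z)) (R - (openGraph ω).dist 0 x) else 0

lemma bump_le {d : ℕ} (ω : Config d) (q R : ℕ) (z x : Zd d) : bump ω q R z x ≤ 2 * q := by
  unfold bump
  split_ifs <;> omega

lemma mem_of_bump_ne_zero {d : ℕ} {ω : Config d} {q R : ℕ} {z x : Zd d}
    (h : bump ω q R z x ≠ 0) : x ∈ graphBall ω R ∧ x ∈ supBall z (2 * q) := by
  unfold bump at h
  split_ifs at h with hr
  · rw [mem_supBall]
    exact ⟨⟨hr, by omega⟩, by omega⟩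
  · exact absurd rfl h

lemma bump_le_succ {d : ℕ} {ω : Config d} (q R : ℕ) (z : Zd d) {x y : Zd d}
    (h : openAdj ω x y) : bump ω q R z x ≤ bump ω q R z y + 1 := by
  unfold bump
  by_cases hx : (openGraph ω).Reachable 0 x
  · have hxy : (openGraph ω).Adj x y := h
    have hy : (openGraph ω).Reachable 0 y := hx.trans hxy.reachable
    rw [if_pos hx, if_pos hy]
    have h1 := dist_le_succ hx h
    have h2 := supN_sub_le y x z
    have h3 := h.symm.1.supN_le
    omega
  · rw [if_neg hx]
    omega

lemma le_bump {d : ℕ} {ω : Config d} {q r : ℕ} {z x : Zd d} (hx : x ∈ graphBall ω r)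
    (hz : z ∈ supBall x q) : q ≤ bump ω q (r + 2 * q) z x := by
  have h1 := hx.2
  rw [mem_supBall, supN_sub_comm] at hz
  rw [bump, if_pos hx.1]
  omega

lemma bump_sub_sq_le {d : ℕ} {ω : Config d} (q R : ℕ) (z : Zd d) {x y : Zd d}
    (h : openAdj ω x y) : ((bump ω q R z x : ℝ) - bump ω q R z y) ^ 2 ≤ 1 := by
  have h1 : (bump ω q R z x : ℝ) ≤ bump ω q R z y + 1 := by exact_mod_cast bump_le_succ q R z h
  have h2 : (bump ω q R z y : ℝ) ≤ bump ω q R z x + 1 := by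
    exact_mod_cast bump_le_succ q R z h.symm
  rw [sq_le_one_iff_abs_le_one, abs_le]
  constructor <;> linarith

/-- Averaging over the centre `z` of the bump function. -/
lemma exists_bump_center {d : ℕ} {ω : Config d} (hω : (cluster ω).Infinite) {q r : ℕ} (hq : 1 ≤ q)
    (hr : (graphBall ω (r + 2 * q)).ncard ≤ 2 * (graphBall ω r).ncard) :
    ∃ (z : Zd d) (U : Finset (Zd d)), U.card ≤ (4 * q + 1) ^ d ∧
      (∀ x, x ∈ U ↔ x ∈ graphBall ω (r + 2 * q) ∧ x ∈ supBall z (2 * q)) ∧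
      (q : ℝ) ^ 2 * U.card < 2 ^ (d + 2) *
        ip ω U (fun x => bump ω q (r + 2 * q) z x) (fun x => bump ω q (r + 2 * q) z x) := by
  classical
  set S := (finite_graphBall ω (r + 2 * q)).toFinset with hS
  set S₀ := (finite_graphBall ω r).toFinset with hS₀
  have hSS : S₀ ⊆ S := fun x hx => by
    simp only [hS, hS₀, Set.Finite.mem_toFinset] at *
    exact ⟨hx.1, hx.2.trans (by omega)⟩
  have hcard : S.card ≤ 2 * S₀.card := by
    rwa [Set.ncard_eq_toFinset_card _ (finite_graphBall ω _),
      Set.ncard_eq_toFinset_card _ (finite_graphBall ω _)] at hr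
  have hS₀pos : 0 < S₀.card := Finset.card_pos.2 ⟨0, by simpa [hS₀] using zero_mem_graphBall ω r⟩
  set Z : Finset (Zd d) := supBall 0 (r + q) with hZ
  let U : Zd d → Finset (Zd d) := fun z => S.filter fun x => x ∈ supBall z (2 * q)
  let F : Zd d → Zd d → ℝ := fun z x => bump ω q (r + 2 * q) z x
  have hsumU : ∑ z ∈ Z, (U z).card ≤ S.card * (4 * q + 1) ^ d := by
    simp only [U, Finset.card_filter]
    rw [Finset.sum_comm]
    calc ∑ x ∈ S, ∑ z ∈ Z, (if x ∈ supBall z (2 * q) then 1 else 0)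
        ≤ ∑ _x ∈ S, (4 * q + 1) ^ d := by
          refine Finset.sum_le_sum fun x _ => ?_
          rw [← Finset.card_filter]
          have := Finset.card_le_card (s := Z.filter fun z => x ∈ supBall z (2 * q))
            (t := supBall x (2 * q))
            fun z hz => mem_supBall_comm.1 (Finset.mem_filter.1 hz).2
          rwa [card_supBall, show 2 * (2 * q) = 4 * q by ring] at this
      _ = S.card * (4 * q + 1) ^ d := by rw [Finset.sum_const, smul_eq_mul]
  have hsumA : (q : ℝ) ^ 2 * (S₀.card * (2 * q + 1) ^ d) ≤ ∑ z ∈ Z, ip ω (U z) (F z) (F z) := by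
    have h1 : ∀ z ∈ Z, ∑ x ∈ S₀, (if z ∈ supBall x q then (q : ℝ) ^ 2 else 0) ≤
        ip ω (U z) (F z) (F z) := by
      intro z _
      rw [← Finset.sum_filter]
      have hsub : S₀.filter (fun x => z ∈ supBall x q) ⊆ U z := fun x hx => by
        rw [Finset.mem_filter] at hx
        refine Finset.mem_filter.2 ⟨hSS hx.1, ?_⟩
        have := mem_supBall.1 (mem_supBall_comm.1 hx.2)
        exact mem_supBall.2 (by omega)
      refine le_trans (Finset.sum_le_sum fun x hx => ?_)
        (Finset.sum_le_sum_of_subset_of_nonneg hsub fun x _ _ =>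
          mul_nonneg (Nat.cast_nonneg _) (mul_self_nonneg _))
      rw [Finset.mem_filter, hS₀, Set.Finite.mem_toFinset] at hx
      have h2 : (q : ℝ) ≤ F z x := Nat.cast_le.2 (le_bump hx.1 hx.2)
      have h3 : (1 : ℝ) ≤ nu ω x := by
        exact_mod_cast nu_pos_of_mem_cluster hω (mem_cluster_iff.2 hx.1.1)
      have hq0 : (0 : ℝ) ≤ q := Nat.cast_nonneg q
      nlinarith [mul_le_mul h2 h2 hq0 (hq0.trans h2)]
    refine le_trans (le_of_eq ?_) (Finset.sum_le_sum h1)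
    rw [Finset.sum_comm]
    have h4 : ∀ x ∈ S₀, ∑ z ∈ Z, (if z ∈ supBall x q then (q : ℝ) ^ 2 else 0) =
        (q : ℝ) ^ 2 * (2 * q + 1) ^ d := by
      intro x hx
      rw [hS₀, Set.Finite.mem_toFinset] at hx
      rw [← Finset.sum_filter, Finset.sum_const]
      have : Z.filter (fun z => z ∈ supBall x q) = supBall x q := by
        ext z
        simp only [Finset.mem_filter, and_iff_right_iff_imp]
        intro hz
        have h5 := mem_supBall.1 (graphBall_subset ω r hx)
        have h6 := supN_sub_le z x 0
        have h7 := mem_supBall.1 hz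
        exact mem_supBall.2 (by omega)
      rw [this, card_supBall, nsmul_eq_mul, mul_comm]
      push_cast
      rfl
    rw [Finset.sum_congr rfl h4, Finset.sum_const, nsmul_eq_mul]
    ring
  have hA0 : 0 < ∑ z ∈ Z, ip ω (U z) (F z) (F z) := by
    refine lt_of_lt_of_le ?_ hsumA
    have : (0 : ℝ) < S₀.card := by exact_mod_cast hS₀pos
    have : (0 : ℝ) < q := by exact_mod_cast hq
    positivity
  have hlt : ∑ z ∈ Z, (q : ℝ) ^ 2 * (U z).card <
      ∑ z ∈ Z, 2 ^ (d + 2) * ip ω (U z) (F z) (F z) := by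
    rw [← Finset.mul_sum, ← Finset.mul_sum]
    have h1 : (∑ z ∈ Z, ((U z).card : ℝ)) ≤ S.card * (4 * q + 1) ^ d := by exact_mod_cast hsumU
    have h2 : (S.card : ℝ) ≤ 2 * S₀.card := by exact_mod_cast hcard
    have h3 : (4 * (q : ℝ) + 1) ^ d ≤ 2 ^ d * (2 * q + 1) ^ d := by
      rw [← mul_pow]
      gcongr
      linarith
    calc (q : ℝ) ^ 2 * ∑ z ∈ Z, ((U z).card : ℝ)
        ≤ (q : ℝ) ^ 2 * ((2 * S₀.card) * (2 ^ d * (2 * q + 1) ^ d)) := by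
          refine mul_le_mul_of_nonneg_left (h1.trans ?_) (by positivity)
          exact mul_le_mul h2 h3 (by positivity) (by positivity)
      _ = 2 ^ (d + 1) * ((q : ℝ) ^ 2 * (S₀.card * (2 * q + 1) ^ d)) := by ring
      _ ≤ 2 ^ (d + 1) * ∑ z ∈ Z, ip ω (U z) (F z) (F z) := by gcongr
      _ < 2 ^ (d + 2) * ∑ z ∈ Z, ip ω (U z) (F z) (F z) := by
          refine mul_lt_mul_of_pos_right ?_ hA0
          exact pow_lt_pow_right₀ (by norm_num) (by omega)
  obtain ⟨z, _, hz⟩ := Finset.exists_lt_of_sum_lt hlt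
  refine ⟨z, U z, ?_, fun x => ?_, hz⟩
  · have := Finset.card_le_card (s := U z) (t := supBall z (2 * q))
      fun x hx => (Finset.mem_filter.1 hx).2
    rwa [card_supBall, show 2 * (2 * q) = 4 * q by ring] at this
  · simp [U, hS]

/-- A region of volume of order `q ^ d`, close to the origin, in which the walk survives with an
exponential rate of order `q ^ (-2)`. -/
lemma exists_trap {d : ℕ} {ω : Config d} (hω : (cluster ω).Infinite) {q : ℕ} (hq : 1 ≤ q)
    (hJ : (2 * (q * (2 * q)) + 1) ^ d < 2 ^ q) {K : ℝ} (hK : K = 3 ^ d * 2 ^ (d + 2))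
    (hKq : K ≤ q ^ 2) (k : ℕ) :
    ∃ (U : Finset (Zd d)), U.card ≤ (4 * q + 1) ^ d ∧
      ∃ x ∈ U, x ∈ graphBall ω (2 * q ^ 2) ∧
        (1 - K / q ^ 2) ^ 2 ^ k / (4 * K) ≤ stay ω U (2 ^ k) x := by
  obtain ⟨j, hj, hdouble⟩ := exists_doubling ω (2 * q) q hJ
  rw [show (j + 1) * (2 * q) = j * (2 * q) + 2 * q by ring] at hdouble
  obtain ⟨z, U, hUc, hU, hlt⟩ := exists_bump_center hω hq hdouble
  set F : Zd d → ℝ := fun x => bump ω q (j * (2 * q) + 2 * q) z x with hF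
  have hF0 : ∀ x, 0 ≤ F x := fun x => Nat.cast_nonneg _
  have hFq : ∀ x, F x ≤ 2 * q := fun x => by
    have h := bump_le ω q (j * (2 * q) + 2 * q) z x
    simp only [hF]
    exact_mod_cast h
  have hq0 : (0 : ℝ) < q := by exact_mod_cast hq
  have hK0 : 0 < K := by rw [hK]; positivity
  have hA : 0 < ip ω U F F := by
    have : 0 < 2 ^ (d + 2) * ip ω U F F := lt_of_le_of_lt (by positivity) hlt
    exact pos_of_mul_pos_right this (by positivity)
  have hen := ip_sub_ip_killed_le ω U F
    (fun x hx => by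
      by_contra hc
      exact hx ((hU x).2 (mem_of_bump_ne_zero fun h => hc (by simp [hF, h]))))
    (fun x y h => bump_sub_sq_le q _ z h)
  have hθ : 0 ≤ 1 - K / q ^ 2 := by
    rw [sub_nonneg, div_le_one (by positivity)]
    exact hKq
  have hray : (1 - K / q ^ 2) * ip ω U F F ≤ ip ω U F (killed ω U F) := by
    have h1 : (3 : ℝ) ^ d * U.card ≤ K / q ^ 2 * ip ω U F F := by
      rw [div_mul_eq_mul_div, le_div_iff₀ (by positivity), hK]
      calc (3 : ℝ) ^ d * U.card * q ^ 2 = 3 ^ d * (q ^ 2 * U.card) := by ring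
        _ ≤ 3 ^ d * (2 ^ (d + 2) * ip ω U F F) := by gcongr
        _ = _ := by ring
    linarith
  have hpow := pow_mul_le_ip_iterate hθ hA hray k
  have hUne : U.Nonempty := by
    by_contra hc
    rw [Finset.not_nonempty_iff_eq_empty] at hc
    simp [ip, hc] at hA
  have hex : ∃ x ∈ U, (1 - K / q ^ 2) ^ 2 ^ k / (4 * K) ≤ stay ω U (2 ^ k) x := by
    by_contra! hc
    have h1 : ip ω U F ((killed ω U)^[2 ^ k] F) ≤
        ∑ x ∈ U, 3 ^ d * ((2 * q) * ((2 * q) * stay ω U (2 ^ k) x)) := by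
      refine Finset.sum_le_sum fun x _ => ?_
      have h2 : (nu ω x : ℝ) ≤ 3 ^ d := by exact_mod_cast nu_le ω x
      have h3 := iterate_killed_le (ω := ω) (W := U) hFq (2 ^ k) x
      have h4 : (0 : ℝ) ≤ 2 * q * stay ω U (2 ^ k) x :=
        mul_nonneg (by positivity) (stay_nonneg _ _)
      calc (nu ω x : ℝ) * (F x * (killed ω U)^[2 ^ k] F x)
          ≤ nu ω x * (F x * (2 * q * stay ω U (2 ^ k) x)) :=
            mul_le_mul_of_nonneg_left (mul_le_mul_of_nonneg_left h3 (hF0 x)) (Nat.cast_nonneg _)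
        _ ≤ 3 ^ d * ((2 * q) * ((2 * q) * stay ω U (2 ^ k) x)) :=
            mul_le_mul h2 (mul_le_mul_of_nonneg_right (hFq x) h4)
              (mul_nonneg (hF0 x) h4) (by positivity)
    have h5 : ∑ x ∈ U, 3 ^ d * ((2 * q) * ((2 * q) * stay ω U (2 ^ k) x)) <
        ∑ _x ∈ U, 3 ^ d * ((2 * q) * ((2 * q) * ((1 - K / q ^ 2) ^ 2 ^ k / (4 * K)))) := by
      refine Finset.sum_lt_sum_of_nonempty hUne fun x hx => ?_
      have := hc x hx
      gcongr
    rw [Finset.sum_const, nsmul_eq_mul] at h5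
    have h6 : (U.card : ℝ) * (3 ^ d * ((2 * q) * ((2 * q) * ((1 - K / q ^ 2) ^ 2 ^ k / (4 * K)))))
        = (1 - K / q ^ 2) ^ 2 ^ k * (q ^ 2 * U.card / 2 ^ (d + 2)) := by
      have : K / 3 ^ d = 2 ^ (d + 2) := by rw [hK]; field_simp
      rw [← this]
      field_simp
      ring
    have h7 : (1 - K / q ^ 2) ^ 2 ^ k * (q ^ 2 * U.card / 2 ^ (d + 2)) ≤
        (1 - K / q ^ 2) ^ 2 ^ k * ip ω U F F := by
      refine mul_le_mul_of_nonneg_left ?_ (pow_nonneg hθ _)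
      rw [div_le_iff₀ (by positivity), mul_comm (ip ω U F F)]
      exact hlt.le
    linarith
  obtain ⟨x, hx, hstay⟩ := hex
  refine ⟨U, hUc, x, hx, ?_, hstay⟩
  obtain ⟨hr, hd⟩ := ((hU x).1 hx).1
  refine ⟨hr, hd.trans ?_⟩
  nlinarith

/-! ### The lower bound -/

lemma exp_neg_two_mul_le_one_sub {t : ℝ} (h0 : 0 ≤ t) (h1 : t ≤ 1 / 2) :
    Real.exp (-(2 * t)) ≤ 1 - t := by
  rw [Real.exp_neg]
  refine inv_le_of_inv_le₀ (by linarith) (le_trans ?_ (Real.add_one_le_exp (2 * t)))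
  rw [inv_le_iff_one_le_mul₀ (by linarith)]
  nlinarith

lemma eventually_growth (d : ℕ) :
    ∀ᶠ q : ℕ in Filter.atTop, (2 * (q * (2 * q)) + 1) ^ d < 2 ^ q := by
  have h := (isLittleO_pow_const_const_pow_of_one_lt (R := ℝ) (2 * d)
    (one_lt_two)).def (c := (2 * 5 ^ d)⁻¹) (by positivity)
  filter_upwards [h, Filter.eventually_ge_atTop 1] with q hq hq1
  rw [Real.norm_of_nonneg (by positivity), Real.norm_of_nonneg (by positivity)] at hq
  have hq1' : (1 : ℝ) ≤ q := by exact_mod_cast hq1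
  have h2 : (0 : ℝ) < 2 ^ q := by positivity
  have h3 : (2 * ((q : ℝ) * (2 * q)) + 1) ^ d < 2 ^ q := by
    calc (2 * ((q : ℝ) * (2 * q)) + 1) ^ d ≤ (5 * (q : ℝ) ^ 2) ^ d := by
          gcongr
          nlinarith
      _ = 5 ^ d * (q : ℝ) ^ (2 * d) := by rw [mul_pow, pow_mul]
      _ ≤ 5 ^ d * ((2 * 5 ^ d)⁻¹ * 2 ^ q) := by gcongr
      _ = 2 ^ q / 2 := by field_simp
      _ < 2 ^ q := by linarith
  exact_mod_cast h3

/-- Deterministic lower bound, valid for every infinite open cluster. -/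
lemma exp_neg_le_laplaceN {d : ℕ} (hd : 2 ≤ d) {α : ℝ} (hα : α ∈ Set.Ioo (0 : ℝ) 1) :
    ∃ C > (0 : ℝ), ∃ q₀ : ℕ, ∀ ω : Config d, (cluster ω).Infinite → ∀ q ≥ q₀, ∀ n : ℕ,
      1 ≤ n → n ≤ q ^ (d + 2) → Real.exp (-C * (q : ℝ) ^ d) ≤ LaplaceN ω α n := by
  classical
  obtain ⟨K, hK⟩ : ∃ K : ℝ, K = 3 ^ d * 2 ^ (d + 2) := ⟨_, rfl⟩
  have hK1 : 1 ≤ K := by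
    rw [hK]
    exact one_le_mul_of_one_le_of_one_le (one_le_pow₀ (by norm_num)) (one_le_pow₀ (by norm_num))
  have hK0 : 0 < K := by linarith
  have hlogα : 0 < -Real.log α := neg_pos.2 (Real.log_neg hα.1 hα.2)
  have hlog3 : 0 ≤ Real.log (3 ^ d) := Real.log_nonneg (one_le_pow₀ (by norm_num))
  have hlogK : 0 ≤ Real.log (4 * K) := Real.log_nonneg (by linarith)
  obtain ⟨q₁, hq₁⟩ := Filter.eventually_atTop.1 (eventually_growth d)
  refine ⟨-Real.log α * (5 ^ d + 3) + Real.log (3 ^ d) * 2 + 4 * K + Real.log (4 * K),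
    by positivity, max (max 1 q₁) ⌈2 * K⌉₊, ?_⟩
  intro ω hω q hq n hn hnq
  have hq1 : 1 ≤ q := le_trans (le_trans (le_max_left _ _) (le_max_left _ _)) hq
  have hgrow := hq₁ q (le_trans (le_trans (le_max_right _ _) (le_max_left _ _)) hq)
  have hq2K : 2 * K ≤ q := (Nat.le_ceil _).trans (by exact_mod_cast (le_max_right _ _).trans hq)
  have hq1' : (1 : ℝ) ≤ q := by exact_mod_cast hq1
  have hq0 : (0 : ℝ) < q := by linarith
  have hKq : 2 * K ≤ (q : ℝ) ^ 2 := by nlinarith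
  have hqd : q ^ 2 ≤ q ^ d := Nat.pow_le_pow_right hq1 hd
  have hqd1 : 1 ≤ q ^ d := Nat.one_le_pow _ _ hq1
  set k := Nat.log 2 n + 1 with hk
  have hnk : n ≤ 2 ^ k := (Nat.lt_pow_succ_log_self (by norm_num) n).le
  have hkn : 2 ^ k ≤ 2 * n := by
    have := Nat.pow_log_le_self 2 (x := n) (by omega)
    rw [hk, pow_succ]
    omega
  obtain ⟨U, hUc, x, -, hxball, hstay⟩ := exists_trap hω hq1 hgrow hK (by linarith) k
  obtain ⟨w, hw⟩ := hxball.1.exists_walk_length_eq_dist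
  have hwlen : w.length ≤ 2 * q ^ d := by
    have := hxball.2
    omega
  set W : Finset (Zd d) := U ∪ w.support.toFinset with hW
  have hWc : W.card ≤ (5 ^ d + 3) * q ^ d := by
    have h1 : W.card ≤ _ := Finset.card_union_le U w.support.toFinset
    have h2 := List.toFinset_card_le w.support
    rw [SimpleGraph.Walk.length_support] at h2
    have h3 : (4 * q + 1) ^ d ≤ 5 ^ d * q ^ d := by
      rw [← mul_pow]
      exact Nat.pow_le_pow_left (by omega) d
    rw [add_mul]
    omega
  have h0W : (0 : Zd d) ∈ W :=
    Finset.mem_union_right _ (List.mem_toFinset.2 w.start_mem_support)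
  have hlap := pow_card_mul_stay_le_laplaceN (ω := ω) h0W hα n
  have hqdR : (0 : ℝ) < (q : ℝ) ^ d := by positivity
  have e1 : Real.exp (-(-Real.log α * (5 ^ d + 3) * (q : ℝ) ^ d)) ≤ α ^ W.card := by
    rw [← Real.exp_log hα.1, ← Real.exp_nat_mul, Real.exp_le_exp, Real.log_exp]
    have : (W.card : ℝ) ≤ (5 ^ d + 3) * (q : ℝ) ^ d := by exact_mod_cast hWc
    nlinarith
  have e2 : Real.exp (-(Real.log (3 ^ d) * 2 * (q : ℝ) ^ d)) ≤ ((3 : ℝ) ^ d)⁻¹ ^ w.length := by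
    have h3 : ((3 : ℝ) ^ d)⁻¹ = Real.exp (-Real.log (3 ^ d)) := by
      rw [Real.exp_neg, Real.exp_log (by positivity)]
    rw [h3, ← Real.exp_nat_mul, Real.exp_le_exp]
    have : (w.length : ℝ) ≤ 2 * (q : ℝ) ^ d := by exact_mod_cast hwlen
    nlinarith
  have e3 : Real.exp (-(4 * K * (q : ℝ) ^ d)) ≤ (1 - K / q ^ 2) ^ 2 ^ k := by
    have ht0 : 0 ≤ K / (q : ℝ) ^ 2 := by positivity
    have ht1 : K / (q : ℝ) ^ 2 ≤ 1 / 2 := by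
      rw [div_le_iff₀ (by positivity)]
      linarith
    refine le_trans ?_ (pow_le_pow_left₀ (Real.exp_pos _).le
      (exp_neg_two_mul_le_one_sub ht0 ht1) _)
    rw [← Real.exp_nat_mul, Real.exp_le_exp]
    have h2k : ((2 ^ k : ℕ) : ℝ) ≤ 2 * (q : ℝ) ^ (d + 2) := by
      exact_mod_cast hkn.trans (Nat.mul_le_mul_left 2 hnq)
    have : ((2 ^ k : ℕ) : ℝ) * (2 * (K / (q : ℝ) ^ 2)) ≤ 4 * K * (q : ℝ) ^ d := by
      calc ((2 ^ k : ℕ) : ℝ) * (2 * (K / (q : ℝ) ^ 2))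
          ≤ 2 * (q : ℝ) ^ (d + 2) * (2 * (K / (q : ℝ) ^ 2)) := by gcongr
        _ = 4 * K * (q : ℝ) ^ d := by rw [pow_add]; field_simp; ring
    linarith
  have e4 : Real.exp (-(Real.log (4 * K) * (q : ℝ) ^ d)) ≤ (4 * K)⁻¹ := by
    have h4 : (4 * K)⁻¹ = Real.exp (-Real.log (4 * K)) := by
      rw [Real.exp_neg, Real.exp_log (by positivity)]
    rw [h4, Real.exp_le_exp]
    have : (1 : ℝ) ≤ (q : ℝ) ^ d := by exact_mod_cast hqd1
    nlinarith
  have hwalk := le_stay_of_walk (W := W) w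
    (fun z hz => Finset.mem_union_right _ (List.mem_toFinset.2 hz)) (2 ^ k)
  calc Real.exp (-(-Real.log α * (5 ^ d + 3) + Real.log (3 ^ d) * 2 + 4 * K + Real.log (4 * K))
        * (q : ℝ) ^ d)
      = Real.exp (-(-Real.log α * (5 ^ d + 3) * (q : ℝ) ^ d)) *
        (Real.exp (-(Real.log (3 ^ d) * 2 * (q : ℝ) ^ d)) *
        (Real.exp (-(4 * K * (q : ℝ) ^ d)) * Real.exp (-(Real.log (4 * K) * (q : ℝ) ^ d)))) := by
        rw [← Real.exp_add, ← Real.exp_add, ← Real.exp_add]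
        congr 1
        ring
    _ ≤ α ^ W.card * (((3 : ℝ) ^ d)⁻¹ ^ w.length * ((1 - K / q ^ 2) ^ 2 ^ k * (4 * K)⁻¹)) := by
        have := hα.1
        have := (Real.exp_pos _).le.trans e3
        gcongr
    _ ≤ α ^ W.card * stay ω W n 0 := by
        refine mul_le_mul_of_nonneg_left ?_ (pow_nonneg hα.1.le _)
        refine le_trans ?_ (hwalk.trans (stay_antitone 0 (hnk.trans (Nat.le_add_left _ _))))
        refine mul_le_mul_of_nonneg_left ?_ (by positivity)
        exact hstay.trans (stay_mono Finset.subset_union_left _ _)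
    _ ≤ LaplaceN ω α n := hlap

/-- lower bound for the Laplace transform of the number of visited points. -/
theorem stmt15 (d : ℕ) (hd : 2 ≤ d) (p : ℝ) (hp : pc d < p) (hp1 : p ≤ 1)
    (α : ℝ) (hα : α ∈ Set.Ioo (0 : ℝ) 1) :
    ∃ c > (0 : ℝ),
      ∀ Q : Measure (Config d), IsBernoulli p Q →
        ∀ᵐ ω ∂Q, (cluster ω).Infinite →
          ∃ N : ℕ, ∀ n ≥ N,
            Real.exp (-c * (n : ℝ) ^ ((d : ℝ) / ((d : ℝ) + 2))) ≤ LaplaceN ω α n := by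
  obtain ⟨C, hC, q₀, h⟩ := exp_neg_le_laplaceN hd hα
  refine ⟨C * 2 ^ d, by positivity, fun Q _ => Filter.Eventually.of_forall fun ω hω => ?_⟩
  refine ⟨max 1 (q₀ ^ (d + 2)), fun n hn => ?_⟩
  have hn1 : 1 ≤ n := (le_max_left _ _).trans hn
  have hn1' : (1 : ℝ) ≤ n := by exact_mod_cast hn1
  have hn0 : (0 : ℝ) ≤ n := by linarith
  set s : ℝ := (n : ℝ) ^ (((d + 2 : ℕ) : ℝ)⁻¹) with hs
  have hspow : s ^ (d + 2) = n := Real.rpow_inv_natCast_pow hn0 (by omega)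
  have hs1 : 1 ≤ s := Real.one_le_rpow hn1' (by positivity)
  have hsd : s ^ d = (n : ℝ) ^ ((d : ℝ) / ((d : ℝ) + 2)) := by
    rw [hs, ← Real.rpow_mul_natCast hn0]
    congr 1
    push_cast
    rw [mul_comm, div_eq_mul_inv]
  have hq₀ : q₀ ≤ ⌈s⌉₊ := by
    have h1 : (q₀ : ℝ) ^ (d + 2) ≤ s ^ (d + 2) := by
      rw [hspow]
      exact_mod_cast (le_max_right _ _).trans hn
    have h2 : (q₀ : ℝ) ≤ s := le_of_pow_le_pow_left₀ (by omega) (by linarith) h1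
    exact_mod_cast h2.trans (Nat.le_ceil s)
  have hnq : n ≤ ⌈s⌉₊ ^ (d + 2) := by
    have h1 : s ^ (d + 2) ≤ (⌈s⌉₊ : ℝ) ^ (d + 2) :=
      pow_le_pow_left₀ (by linarith) (Nat.le_ceil s) _
    rw [hspow] at h1
    exact_mod_cast h1
  refine le_trans ?_ (h ω hω ⌈s⌉₊ hq₀ n hn1 hnq)
  have hceil : (⌈s⌉₊ : ℝ) ≤ 2 * s := by
    have := Nat.ceil_lt_add_one (a := s) (by linarith)
    linarith
  have hd' : (⌈s⌉₊ : ℝ) ^ d ≤ 2 ^ d * s ^ d := by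
    rw [← mul_pow]
    exact pow_le_pow_left₀ (Nat.cast_nonneg _) hceil d
  rw [Real.exp_le_exp, ← hsd]
  nlinarith

end Perco
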